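/- arXiv:1608.07243 — 4 statements merged into one kernel-verified Lean document; each statement's English description precedes it below -/
import Mathlib

section
/- Let Ω = {(q1,q2,q3) ∈ ℝ³ : 0 < q2 < π, 0 < q3 < π} and ρ = sin²(q3)·sin(q2). Let Δ₃ be as for the metric g^{11} = 16/(sin²q3·sin²q2), g^{22} = 4/sin²q3, g^{33} = 1, i.e. Δ₃ f = ρ⁻¹·Σ_{a,b=1}^{3} ∂_a(ρ·g^{ab}·∂_b f), and let Δ_{K2} f = ρ⁻¹·Σ_{a,b=1}^{3} ∂_a(ρ·K^{ab}·∂_b f) with K^{11} = −8·cos(q1)·cos²q2/sin²q2, K^{12} = K^{21} = −4·sin(q1)·cos q2/sin q2, K^{22} = 2·cos(q1), all other components zero. Set E₃ = −(3/4)·(1 + 1/sin²q3). Then the operators A f = Δ₃ f + E₃·f and Δ_{K2} commute: A(Δ_{K2} f) = Δ_{K2}(A f) for every smooth f : Ω → ℝ. -/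
open Real

/-- Partial derivative of `f` with respect to the `i`-th coordinate. -/
noncomputable def pd {n : ℕ} (i : Fin n) (f : (Fin n → ℝ) → ℝ) (x : Fin n → ℝ) : ℝ :=
  deriv (fun t => f (Function.update x i t)) (x i)

/-- The operator `f ↦ ρ⁻¹ ∑ a b, ∂_a (ρ K^{ab} ∂_b f)` (Laplace–Beltrami-type
quantization of the symmetric tensor field `K` with respect to the weight `ρ`). -/
noncomputable def lapOp {n : ℕ} (ρ : (Fin n → ℝ) → ℝ) (K : (Fin n → ℝ) → Fin n → Fin n → ℝ)
    (f : (Fin n → ℝ) → ℝ) (x : Fin n → ℝ) : ℝ :=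
  (ρ x)⁻¹ * ∑ a, ∑ b, pd a (fun y => ρ y * K y a b * pd b f y) x

/-- Weight `ρ = sin²(q3)·sin(q2)`. -/
noncomputable def rho (x : Fin 3 → ℝ) : ℝ := (sin (x 2))^2 * sin (x 1)

/-- Inverse metric `g¹¹ = 16/(sin²q3 sin²q2)`, `g²² = 4/sin²q3`, `g³³ = 1`. -/
noncomputable def gmat (x : Fin 3 → ℝ) : Fin 3 → Fin 3 → ℝ :=
  ![![16/((sin (x 2))^2 * (sin (x 1))^2), 0, 0],
    ![0, 4/(sin (x 2))^2, 0],
    ![0, 0, 1]]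

/-- The Killing tensor of `K2`, viewed in three dimensions. -/
noncomputable def K2mat (x : Fin 3 → ℝ) : Fin 3 → Fin 3 → ℝ :=
  ![![-8 * cos (x 0) * (cos (x 1))^2/(sin (x 1))^2,
       -4 * sin (x 0) * cos (x 1)/sin (x 1), 0],
    ![-4 * sin (x 0) * cos (x 1)/sin (x 1), 2 * cos (x 0), 0],
    ![0, 0, 0]]

/-- Quantum correction `E₃ = −(3/4)(1 + 1/sin²q3)`. -/
noncomputable def E3 (x : Fin 3 → ℝ) : ℝ := -(3/4) * (1 + 1/(sin (x 2))^2)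

/-- `A f = Δ₃ f + E₃ f`. -/
noncomputable def opA (f : (Fin 3 → ℝ) → ℝ) (x : Fin 3 → ℝ) : ℝ :=
  lapOp rho gmat f x + E3 x * f x

open TopologicalSpace

section SmoothFunctions

variable {n : ℕ}

theorem pd_congr {U : Opens (Fin n → ℝ)} {f g : (Fin n → ℝ) → ℝ}
    (h : ∀ x ∈ U, f x = g x) (i : Fin n) {x : Fin n → ℝ} (hx : x ∈ U) :
    pd i f x = pd i g x := by
  apply Filter.EventuallyEq.deriv_eq
  have hc : Filter.Tendsto (fun t => Function.update x i t) (nhds (x i)) (nhds x) := by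
    have : Continuous (fun t => Function.update x i t) := continuous_const.update i continuous_id
    simpa using this.tendsto (x i)
  filter_upwards [hc.eventually (U.isOpen.mem_nhds hx)] with t ht using h _ ht

theorem pd_eq_fderiv {f : (Fin n → ℝ) → ℝ} {x : Fin n → ℝ} (hf : DifferentiableAt ℝ f x)
    (i : Fin n) : pd i f x = fderiv ℝ f x (Pi.single i 1) := by
  have h1 : HasDerivAt (Function.update x i) (Pi.single i 1) (x i) := hasDerivAt_update x i (x i)
  have h2 : HasFDerivAt f (fderiv ℝ f x) (Function.update x i (x i)) := by
    simpa using hf.hasFDerivAt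
  exact (h2.comp_hasDerivAt (x i) h1).deriv

variable {U : Opens (Fin n → ℝ)} {f : (Fin n → ℝ) → ℝ}

theorem ContDiffOn.differentiableAt_of_mem_opens (hf : ContDiffOn ℝ (⊤ : ℕ∞) f U)
    {x : Fin n → ℝ} (hx : x ∈ U) : DifferentiableAt ℝ f x :=
  (hf.contDiffAt (U.isOpen.mem_nhds hx)).differentiableAt (by simp)

theorem ContDiffOn.pd (hf : ContDiffOn ℝ (⊤ : ℕ∞) f U) (i : Fin n) :
    ContDiffOn ℝ (⊤ : ℕ∞) (pd i f) U := by
  have h : ContDiffOn ℝ (⊤ : ℕ∞) (fun x => fderiv ℝ f x (Pi.single i 1)) U :=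
    (hf.fderiv_of_isOpen U.isOpen (by simp)).clm_apply contDiffOn_const
  exact h.congr fun x hx => pd_eq_fderiv (hf.differentiableAt_of_mem_opens hx) i

theorem pd_comm (hf : ContDiffOn ℝ (⊤ : ℕ∞) f U) (i j : Fin n) {x : Fin n → ℝ} (hx : x ∈ U) :
    pd i (pd j f) x = pd j (pd i f) x := by
  have hd : DifferentiableAt ℝ (fderiv ℝ f) x :=
    ((hf.fderiv_of_isOpen (m := (⊤ : ℕ∞)) U.isOpen (by simp)).contDiffAt
      (U.isOpen.mem_nhds hx)).differentiableAt (by simp)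
  have key (i j : Fin n) :
      pd i (pd j f) x = fderiv ℝ (fderiv ℝ f) x (Pi.single i 1) (Pi.single j 1) := by
    rw [pd_congr (fun y hy => pd_eq_fderiv (hf.differentiableAt_of_mem_opens hy) j) i hx,
      pd_eq_fderiv (hd.clm_apply (differentiableAt_const _)),
      fderiv_clm_apply hd (differentiableAt_const _)]
    simp
  rw [key, key]
  exact ((hf.contDiffAt (U.isOpen.mem_nhds hx)).isSymmSndFDerivAt
    (by
      rw [minSmoothness_of_isRCLikeNormedField]
      exact WithTop.coe_le_coe.2 (le_top : (2 : ℕ∞) ≤ ⊤))).eq _ _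

variable (U) in
/-- The algebra of smooth real functions on an open set. -/
def smoothFunctions : Subalgebra ℝ (U → ℝ) where
  carrier := {φ | ∃ f : (Fin n → ℝ) → ℝ, ContDiffOn ℝ (⊤ : ℕ∞) f U ∧ ∀ x : U, f x = φ x}
  mul_mem' := by
    rintro _ _ ⟨f, hf, hf'⟩ ⟨g, hg, hg'⟩
    exact ⟨fun x => f x * g x, hf.mul hg, fun x => by simp [hf', hg']⟩
  add_mem' := by
    rintro _ _ ⟨f, hf, hf'⟩ ⟨g, hg, hg'⟩
    exact ⟨fun x => f x + g x, hf.add hg, fun x => by simp [hf', hg']⟩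
  algebraMap_mem' r := ⟨fun _ => r, contDiffOn_const, fun _ => rfl⟩

namespace smoothFunctions

/-- Restriction to `U` of a function that is smooth on `U`. -/
def restrict (f : (Fin n → ℝ) → ℝ) (hf : ContDiffOn ℝ (⊤ : ℕ∞) f U) : smoothFunctions U :=
  ⟨fun x => f x, f, hf, fun _ => rfl⟩

@[simp]
theorem restrict_apply (hf : ContDiffOn ℝ (⊤ : ℕ∞) f U) (x : U) :
    (restrict f hf : U → ℝ) x = f x := rfl

theorem exists_restrict (φ : smoothFunctions U) :
    ∃ (f : (Fin n → ℝ) → ℝ) (hf : ContDiffOn ℝ (⊤ : ℕ∞) f U), φ = restrict f hf := by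
  obtain ⟨f, hf, h⟩ := φ.2
  exact ⟨f, hf, Subtype.ext (funext fun x => (h x).symm)⟩

/-- The partial derivative of a smooth function on an open set. -/
noncomputable def partialFun (i : Fin n) (φ : smoothFunctions U) : smoothFunctions U :=
  restrict (pd i φ.2.choose) (φ.2.choose_spec.1.pd i)

theorem partialFun_restrict (i : Fin n) (hf : ContDiffOn ℝ (⊤ : ℕ∞) f U) :
    partialFun i (restrict f hf) = restrict (pd i f) (hf.pd i) := by
  ext x
  exact pd_congr (fun y hy => (restrict f hf).2.choose_spec.2 ⟨y, hy⟩) i x.2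

/-- Partial differentiation as a derivation of the algebra of smooth functions. -/
noncomputable def partialD (i : Fin n) : Derivation ℝ (smoothFunctions U) (smoothFunctions U) :=
  Derivation.mk'
    { toFun := partialFun i
      map_add' := by
        intro φ ψ
        obtain ⟨f, hf, rfl⟩ := exists_restrict φ
        obtain ⟨g, hg, rfl⟩ := exists_restrict ψ
        have h : restrict f hf + restrict g hg = restrict (fun x => f x + g x) (hf.add hg) := rfl
        rw [h, partialFun_restrict, partialFun_restrict, partialFun_restrict]
        ext x
        have h1 := hf.differentiableAt_of_mem_opens x.2
        have h2 := hg.differentiableAt_of_mem_opens x.2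
        simp [pd_eq_fderiv h1, pd_eq_fderiv h2, pd_eq_fderiv (h1.fun_add h2),
          fderiv_fun_add h1 h2]
      map_smul' := by
        intro r φ
        obtain ⟨f, hf, rfl⟩ := exists_restrict φ
        have h : r • restrict f hf = restrict (fun x => r * f x) (contDiffOn_const.mul hf) := rfl
        rw [h, partialFun_restrict, partialFun_restrict]
        ext x
        have h1 := hf.differentiableAt_of_mem_opens x.2
        simp [pd_eq_fderiv h1, pd_eq_fderiv (h1.const_mul r), fderiv_const_mul h1] }
    (by
      intro φ ψ
      obtain ⟨f, hf, rfl⟩ := exists_restrict φ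
      obtain ⟨g, hg, rfl⟩ := exists_restrict ψ
      have h : restrict f hf * restrict g hg = restrict (fun x => f x * g x) (hf.mul hg) := rfl
      simp only [LinearMap.coe_mk, AddHom.coe_mk]
      rw [h, partialFun_restrict, partialFun_restrict, partialFun_restrict]
      ext x
      have h1 := hf.differentiableAt_of_mem_opens x.2
      have h2 := hg.differentiableAt_of_mem_opens x.2
      simp [pd_eq_fderiv h1, pd_eq_fderiv h2, pd_eq_fderiv (h1.fun_mul h2),
        fderiv_fun_mul h1 h2])

theorem partialD_restrict (i : Fin n) (hf : ContDiffOn ℝ (⊤ : ℕ∞) f U) :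
    partialD i (restrict f hf) = restrict (pd i f) (hf.pd i) :=
  partialFun_restrict i hf

theorem partialD_comm (i j : Fin n) (φ : smoothFunctions U) :
    partialD i (partialD j φ) = partialD j (partialD i φ) := by
  obtain ⟨f, hf, rfl⟩ := exists_restrict φ
  simp only [partialD_restrict]
  ext x
  exact pd_comm hf i j x.2

variable {ρ : (Fin n → ℝ) → ℝ} {K : (Fin n → ℝ) → Fin n → Fin n → ℝ}

theorem contDiffOn_lapOp (hρ : ContDiffOn ℝ (⊤ : ℕ∞) ρ U) (hρ0 : ∀ x ∈ U, ρ x ≠ 0)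
    (hK : ∀ a b, ContDiffOn ℝ (⊤ : ℕ∞) (fun x => K x a b) U)
    (hf : ContDiffOn ℝ (⊤ : ℕ∞) f U) : ContDiffOn ℝ (⊤ : ℕ∞) (lapOp ρ K f) U :=
  (hρ.inv hρ0).mul <| ContDiffOn.sum fun a _ => ContDiffOn.sum fun b _ =>
    ((hρ.mul (hK a b)).mul (hf.pd b)).pd a

theorem restrict_lapOp (hρ : ContDiffOn ℝ (⊤ : ℕ∞) ρ U) (hρ0 : ∀ x ∈ U, ρ x ≠ 0)
    (hK : ∀ a b, ContDiffOn ℝ (⊤ : ℕ∞) (fun x => K x a b) U)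
    (hf : ContDiffOn ℝ (⊤ : ℕ∞) f U) :
    restrict (lapOp ρ K f) (contDiffOn_lapOp hρ hρ0 hK hf) =
      restrict (fun x => (ρ x)⁻¹) (hρ.inv hρ0) * ∑ a, ∑ b, partialD a
        (restrict ρ hρ * restrict (fun x => K x a b) (hK a b) * partialD b (restrict f hf)) := by
  have h (a b : Fin n) : restrict ρ hρ * restrict (fun x => K x a b) (hK a b) *
      partialD b (restrict f hf) = restrict (fun y => ρ y * K y a b * pd b f y)
        ((hρ.mul (hK a b)).mul (hf.pd b)) := by
    rw [partialD_restrict]; rfl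
  simp only [h]
  simp only [partialD_restrict]
  ext x
  simp [lapOp]

end smoothFunctions

end SmoothFunctions

theorem derivation_ofNat {A : Type*} [CommRing A] [Algebra ℝ A] (D : Derivation ℝ A A) (j : ℕ)
    [j.AtLeastTwo] : D ofNat(j) = 0 :=
  D.map_natCast j

/-- The algebraic core: `c`, `s`, `k` play the roles of `cos q1`, `sin q1`, `cot q2`, while `m`, `w`
and `e` are functions of `q3`. -/
theorem commute_of_derivations {A : Type*} [CommRing A] [Algebra ℝ A]
    (D : Fin 3 → Derivation ℝ A A) (hD : ∀ i j φ, D i (D j φ) = D j (D i φ))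
    {c s k m w e : A}
    (c0 : D 0 c = -s) (c1 : D 1 c = 0) (c2 : D 2 c = 0)
    (s0 : D 0 s = c) (s1 : D 1 s = 0) (s2 : D 2 s = 0)
    (k0 : D 0 k = 0) (k1 : D 1 k = -(1 + k ^ 2)) (k2 : D 2 k = 0)
    (m0 : D 0 m = 0) (m1 : D 1 m = 0) (w0 : D 0 w = 0) (w1 : D 1 w = 0)
    (e0 : D 0 e = 0) (e1 : D 1 e = 0) {L M : A → A}
    (hL : ∀ φ, L φ = w * (D 1 (D 1 φ) + k * D 1 φ + 4 * (1 + k ^ 2) * D 0 (D 0 φ))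
      + D 2 (D 2 φ) + 2 * m * D 2 φ + e * φ)
    (hM : ∀ φ, M φ = 2 * c * D 1 (D 1 φ) - 8 * s * k * D 0 (D 1 φ) - 8 * c * k ^ 2 * D 0 (D 0 φ)
      - 2 * c * k * D 1 φ + 4 * s * (1 + 2 * k ^ 2) * D 0 φ)
    (φ : A) : L (M φ) = M (L φ) := by
  have h10 := hD 1 0
  have h20 := hD 2 0
  have h21 := hD 2 1
  simp only [hL, hM, pow_two, map_add, map_sub, map_neg, Derivation.leibniz,
    Derivation.map_one_eq_zero, derivation_ofNat, smul_eq_mul, c0, c1, c2, s0, s1, s2, k0, k1, k2, m0, m1, w0,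
    w1, e0, e1, h10, h20, h21, mul_zero, add_zero, zero_add, neg_zero]
  ring

/-- The domain `0 < q2 < π`, `0 < q3 < π`. -/
def angleDomain : Opens (Fin 3 → ℝ) where
  carrier := {x | (0 < x 1 ∧ x 1 < π) ∧ (0 < x 2 ∧ x 2 < π)}
  is_open' := by
    have h (i : Fin 3) : IsOpen {x : Fin 3 → ℝ | 0 < x i ∧ x i < π} :=
      isOpen_Ioo.preimage (continuous_apply i)
    exact (h 1).inter (h 2)

namespace angleDomain

open smoothFunctions

theorem sin_one_ne_zero {x : Fin 3 → ℝ} (hx : x ∈ angleDomain) : sin (x 1) ≠ 0 :=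
  (sin_pos_of_pos_of_lt_pi hx.1.1 hx.1.2).ne'

theorem sin_two_ne_zero {x : Fin 3 → ℝ} (hx : x ∈ angleDomain) : sin (x 2) ≠ 0 :=
  (sin_pos_of_pos_of_lt_pi hx.2.1 hx.2.2).ne'

theorem contDiff_sin_coord (i : Fin 3) : ContDiff ℝ (⊤ : ℕ∞) fun x : Fin 3 → ℝ => sin (x i) :=
  contDiff_sin.comp (contDiff_apply ℝ ℝ i)

theorem contDiff_cos_coord (i : Fin 3) : ContDiff ℝ (⊤ : ℕ∞) fun x : Fin 3 → ℝ => cos (x i) :=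
  contDiff_cos.comp (contDiff_apply ℝ ℝ i)

theorem contDiffOn_cot_one :
    ContDiffOn ℝ (⊤ : ℕ∞) (fun x : Fin 3 → ℝ => cos (x 1) / sin (x 1)) angleDomain :=
  (contDiff_cos_coord 1).contDiffOn.div (contDiff_sin_coord 1).contDiffOn
    fun _ hx => sin_one_ne_zero hx

theorem contDiffOn_cot_two :
    ContDiffOn ℝ (⊤ : ℕ∞) (fun x : Fin 3 → ℝ => cos (x 2) / sin (x 2)) angleDomain :=
  (contDiff_cos_coord 2).contDiffOn.div (contDiff_sin_coord 2).contDiffOn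
    fun _ hx => sin_two_ne_zero hx

theorem contDiffOn_four_div_sin_sq :
    ContDiffOn ℝ (⊤ : ℕ∞) (fun x : Fin 3 → ℝ => 4 / sin (x 2) ^ 2) angleDomain :=
  contDiffOn_const.div ((contDiff_sin_coord 2).pow 2).contDiffOn
    fun _ hx => pow_ne_zero 2 (sin_two_ne_zero hx)

theorem contDiffOn_rho : ContDiffOn ℝ (⊤ : ℕ∞) rho angleDomain :=
  (((contDiff_sin_coord 2).pow 2).mul (contDiff_sin_coord 1)).contDiffOn

theorem rho_ne_zero : ∀ x ∈ angleDomain, rho x ≠ 0 := fun _ hx =>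
  mul_ne_zero (pow_ne_zero 2 (sin_two_ne_zero hx)) (sin_one_ne_zero hx)

theorem contDiffOn_E3 : ContDiffOn ℝ (⊤ : ℕ∞) E3 angleDomain :=
  contDiffOn_const.mul <| contDiffOn_const.add <|
    contDiffOn_const.div ((contDiff_sin_coord 2).pow 2).contDiffOn
      fun _ hx => pow_ne_zero 2 (sin_two_ne_zero hx)

theorem contDiffOn_gmat (a b : Fin 3) :
    ContDiffOn ℝ (⊤ : ℕ∞) (fun x => gmat x a b) angleDomain := by
  fin_cases a <;> fin_cases b <;> simp [gmat, contDiffOn_const]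
  · exact contDiffOn_const.div
      (((contDiff_sin_coord 2).pow 2).mul ((contDiff_sin_coord 1).pow 2)).contDiffOn
      fun _ hx => mul_ne_zero (pow_ne_zero 2 (sin_two_ne_zero hx))
        (pow_ne_zero 2 (sin_one_ne_zero hx))
  · exact contDiffOn_four_div_sin_sq

theorem contDiffOn_K2mat (a b : Fin 3) :
    ContDiffOn ℝ (⊤ : ℕ∞) (fun x => K2mat x a b) angleDomain := by
  have h01 : ContDiffOn ℝ (⊤ : ℕ∞)
      (fun x : Fin 3 → ℝ => -(4 * sin (x 0) * cos (x 1)) / sin (x 1)) angleDomain :=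
    ((contDiff_const.mul (contDiff_sin_coord 0)).mul
      (contDiff_cos_coord 1)).neg.contDiffOn.div (contDiff_sin_coord 1).contDiffOn
        fun _ hx => sin_one_ne_zero hx
  fin_cases a <;> fin_cases b <;> simp [K2mat, contDiffOn_const]
  · exact ((contDiff_const.mul (contDiff_cos_coord 0)).mul
      ((contDiff_cos_coord 1).pow 2)).neg.contDiffOn.div
        ((contDiff_sin_coord 1).pow 2).contDiffOn fun _ hx => pow_ne_zero 2 (sin_one_ne_zero hx)
  · exact h01
  · exact h01
  · exact (contDiff_const.mul (contDiff_cos_coord 0)).contDiffOn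

/-- `cos q1` as an element of the algebra of smooth functions. -/
noncomputable def cosA : smoothFunctions angleDomain :=
  restrict (fun x => cos (x 0)) (contDiff_cos_coord 0).contDiffOn

/-- `sin q1` as an element of the algebra of smooth functions. -/
noncomputable def sinA : smoothFunctions angleDomain :=
  restrict (fun x => sin (x 0)) (contDiff_sin_coord 0).contDiffOn

/-- `cot q2` as an element of the algebra of smooth functions. -/
noncomputable def cotA : smoothFunctions angleDomain := restrict _ contDiffOn_cot_one

/-- `cot q3` as an element of the algebra of smooth functions. -/
noncomputable def cotB : smoothFunctions angleDomain := restrict _ contDiffOn_cot_two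

/-- `4 / sin² q3` as an element of the algebra of smooth functions. -/
noncomputable def wA : smoothFunctions angleDomain := restrict _ contDiffOn_four_div_sin_sq

/-- The weight as an element of the algebra of smooth functions. -/
noncomputable def rhoA : smoothFunctions angleDomain := restrict _ contDiffOn_rho

/-- The inverse weight as an element of the algebra of smooth functions. -/
noncomputable def rhoInvA : smoothFunctions angleDomain :=
  restrict _ (contDiffOn_rho.inv rho_ne_zero)

/-- The quantum correction as an element of the algebra of smooth functions. -/
noncomputable def eA : smoothFunctions angleDomain := restrict _ contDiffOn_E3

theorem rhoInvA_mul_rhoA : rhoInvA * rhoA = 1 := by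
  ext x
  exact inv_mul_cancel₀ (rho_ne_zero x x.2)

theorem deriv_cot {t : ℝ} (ht : sin t ≠ 0) :
    deriv (fun t => cos t / sin t) t = -(1 + (cos t / sin t) ^ 2) := by
  rw [((hasDerivAt_cos t).fun_div (hasDerivAt_sin t) ht).deriv]
  field_simp
  ring

theorem partialD_cosA (i : Fin 3) : partialD i cosA = if i = 0 then -sinA else 0 := by
  ext x
  fin_cases i <;> simp [cosA, sinA, partialD_restrict, pd]

theorem partialD_sinA (i : Fin 3) : partialD i sinA = if i = 0 then cosA else 0 := by
  ext x
  fin_cases i <;> simp [cosA, sinA, partialD_restrict, pd]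

theorem partialD_cotA (i : Fin 3) :
    partialD i cotA = if i = 1 then -(1 + cotA ^ 2) else 0 := by
  ext x
  fin_cases i <;> simp [cotA, partialD_restrict, pd, deriv_cot (sin_one_ne_zero x.2)]

theorem partialD_restrict_eq_zero {f : (Fin 3 → ℝ) → ℝ}
    (hf : ContDiffOn ℝ (⊤ : ℕ∞) f angleDomain) {i : Fin 3}
    (h : ∀ x t, f (Function.update x i t) = f x) : partialD i (restrict f hf) = 0 := by
  ext x
  simp [partialD_restrict, pd, h]

theorem partialD_rhoA (i : Fin 3) :
    partialD i rhoA = ![0, cotA * rhoA, 2 * cotB * rhoA] i := by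
  ext x
  have h1 := sin_one_ne_zero x.2
  have h2 := sin_two_ne_zero x.2
  fin_cases i
  · simp [rhoA, partialD_restrict, pd, rho]
  · simp [rhoA, cotA, partialD_restrict, pd, rho]
    field_simp
  · simp [rhoA, cotB, partialD_restrict, pd, rho, two_mul]
    field_simp

theorem partialD_wA {i : Fin 3} (hi : i ≠ 2) : partialD i wA = 0 :=
  partialD_restrict_eq_zero _ fun x t => by rw [Function.update_of_ne hi.symm]

theorem partialD_eA {i : Fin 3} (hi : i ≠ 2) : partialD i eA = 0 :=
  partialD_restrict_eq_zero _ fun x t => by simp [E3, Function.update_of_ne hi.symm]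

theorem partialD_cotB {i : Fin 3} (hi : i ≠ 2) : partialD i cotB = 0 :=
  partialD_restrict_eq_zero _ fun x t => by simp only [Function.update_of_ne hi.symm]

theorem restrict_gmat (a b : Fin 3) : restrict (fun x => gmat x a b) (contDiffOn_gmat a b) =
    ![![4 * wA * (1 + cotA ^ 2), 0, 0], ![0, wA, 0], ![0, 0, 1]] a b := by
  ext x
  fin_cases a <;> fin_cases b <;> try rfl
  have h1 := sin_one_ne_zero x.2
  have h2 := sin_two_ne_zero x.2
  change 16 / (sin (x.1 2) ^ 2 * sin (x.1 1) ^ 2) =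
    4 * (4 / sin (x.1 2) ^ 2) * (1 + (cos (x.1 1) / sin (x.1 1)) ^ 2)
  field_simp
  linarith [sin_sq_add_cos_sq (x.1 1)]

theorem restrict_K2mat (a b : Fin 3) : restrict (fun x => K2mat x a b) (contDiffOn_K2mat a b) =
    ![![-8 * cosA * cotA ^ 2, -4 * sinA * cotA, 0], ![-4 * sinA * cotA, 2 * cosA, 0],
      ![0, 0, 0]] a b := by
  have h01 (x : angleDomain) : -4 * sin (x.1 0) * cos (x.1 1) / sin (x.1 1) =
      -4 * sin (x.1 0) * (cos (x.1 1) / sin (x.1 1)) := by ring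
  ext x
  fin_cases a <;> fin_cases b <;> try rfl
  · change -8 * cos (x.1 0) * cos (x.1 1) ^ 2 / sin (x.1 1) ^ 2 =
      -8 * cos (x.1 0) * (cos (x.1 1) / sin (x.1 1)) ^ 2
    ring
  · exact h01 x
  · exact h01 x

/-- The operator `opA` on the algebra of smooth functions, in expanded form. -/
noncomputable def opAExpanded (φ : smoothFunctions angleDomain) : smoothFunctions angleDomain :=
  wA * (partialD 1 (partialD 1 φ) + cotA * partialD 1 φ +
      4 * (1 + cotA ^ 2) * partialD 0 (partialD 0 φ)) +
    partialD 2 (partialD 2 φ) + 2 * cotB * partialD 2 φ + eA * φ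

/-- The operator `lapOp rho K2mat` on the algebra of smooth functions, in expanded form. -/
noncomputable def opK2Expanded (φ : smoothFunctions angleDomain) : smoothFunctions angleDomain :=
  2 * cosA * partialD 1 (partialD 1 φ) - 8 * sinA * cotA * partialD 0 (partialD 1 φ) -
    8 * cosA * cotA ^ 2 * partialD 0 (partialD 0 φ) - 2 * cosA * cotA * partialD 1 φ +
    4 * sinA * (1 + 2 * cotA ^ 2) * partialD 0 φ

theorem restrict_lapOp_gmat {f : (Fin 3 → ℝ) → ℝ}
    (hf : ContDiffOn ℝ (⊤ : ℕ∞) f angleDomain) :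
    restrict (lapOp rho gmat f) (contDiffOn_lapOp contDiffOn_rho rho_ne_zero contDiffOn_gmat hf) =
      wA * (partialD 1 (partialD 1 (restrict f hf)) + cotA * partialD 1 (restrict f hf) +
        4 * (1 + cotA ^ 2) * partialD 0 (partialD 0 (restrict f hf))) +
      partialD 2 (partialD 2 (restrict f hf)) + 2 * cotB * partialD 2 (restrict f hf) := by
  rw [restrict_lapOp contDiffOn_rho rho_ne_zero contDiffOn_gmat hf]
  change rhoInvA * ∑ a, ∑ b, partialD a (rhoA * _ * _) = _
  generalize restrict f hf = φ
  simp [restrict_gmat, Fin.sum_univ_three, pow_two, partialD_rhoA, partialD_cotA,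
    derivation_ofNat, partialD_wA]
  linear_combination (wA * (partialD 1 (partialD 1 φ) + cotA * partialD 1 φ +
    4 * (1 + cotA ^ 2) * partialD 0 (partialD 0 φ)) + partialD 2 (partialD 2 φ) +
    2 * cotB * partialD 2 φ) * rhoInvA_mul_rhoA

theorem restrict_lapOp_K2mat {f : (Fin 3 → ℝ) → ℝ}
    (hf : ContDiffOn ℝ (⊤ : ℕ∞) f angleDomain) :
    restrict (lapOp rho K2mat f)
        (contDiffOn_lapOp contDiffOn_rho rho_ne_zero contDiffOn_K2mat hf) =
      opK2Expanded (restrict f hf) := by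
  rw [restrict_lapOp contDiffOn_rho rho_ne_zero contDiffOn_K2mat hf]
  change rhoInvA * ∑ a, ∑ b, partialD a (rhoA * _ * _) = _
  generalize restrict f hf = φ
  simp [restrict_K2mat, Fin.sum_univ_three, pow_two, partialD_rhoA, partialD_cotA,
    partialD_cosA, partialD_sinA, derivation_ofNat, partialD_comm 1 0]
  unfold opK2Expanded
  linear_combination (2 * cosA * partialD 1 (partialD 1 φ) -
    8 * sinA * cotA * partialD 0 (partialD 1 φ) - 8 * cosA * cotA ^ 2 * partialD 0 (partialD 0 φ) -
    2 * cosA * cotA * partialD 1 φ + 4 * sinA * (1 + 2 * cotA ^ 2) * partialD 0 φ) *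
    rhoInvA_mul_rhoA

theorem contDiffOn_lapOp_K2mat {f : (Fin 3 → ℝ) → ℝ}
    (hf : ContDiffOn ℝ (⊤ : ℕ∞) f angleDomain) :
    ContDiffOn ℝ (⊤ : ℕ∞) (lapOp rho K2mat f) angleDomain :=
  contDiffOn_lapOp contDiffOn_rho rho_ne_zero contDiffOn_K2mat hf

theorem contDiffOn_opA {f : (Fin 3 → ℝ) → ℝ} (hf : ContDiffOn ℝ (⊤ : ℕ∞) f angleDomain) :
    ContDiffOn ℝ (⊤ : ℕ∞) (opA f) angleDomain :=
  (contDiffOn_lapOp contDiffOn_rho rho_ne_zero contDiffOn_gmat hf).add (contDiffOn_E3.mul hf)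

theorem restrict_opA {f : (Fin 3 → ℝ) → ℝ} (hf : ContDiffOn ℝ (⊤ : ℕ∞) f angleDomain) :
    restrict (opA f) (contDiffOn_opA hf) = opAExpanded (restrict f hf) := by
  rw [opAExpanded, ← restrict_lapOp_gmat hf]
  rfl

theorem opAExpanded_opK2Expanded (φ : smoothFunctions angleDomain) :
    opAExpanded (opK2Expanded φ) = opK2Expanded (opAExpanded φ) := by
  apply commute_of_derivations (A := smoothFunctions angleDomain) (D := fun i => partialD i)
    (hD := partialD_comm) (c := cosA) (s := sinA) (k := cotA) (m := cotB) (w := wA)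
    (e := eA) (L := opAExpanded) (M := opK2Expanded)
  · simp [partialD_cosA]
  · simp [partialD_cosA]
  · simp [partialD_cosA]
  · simp [partialD_sinA]
  · simp [partialD_sinA]
  · simp [partialD_sinA]
  · simp [partialD_cotA]
  · simp [partialD_cotA]
  · simp [partialD_cotA]
  · exact partialD_cotB (by decide)
  · exact partialD_cotB (by decide)
  · exact partialD_wA (by decide)
  · exact partialD_wA (by decide)
  · exact partialD_eA (by decide)
  · exact partialD_eA (by decide)
  · exact fun φ => opAExpanded.eq_1 φ
  · exact fun φ => opK2Expanded.eq_1 φ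

end angleDomain

open smoothFunctions angleDomain in
theorem stmt_9 (f : (Fin 3 → ℝ) → ℝ)
    (hf : ContDiffOn ℝ (⊤ : ℕ∞) f
      {x : Fin 3 → ℝ | (0 < x 1 ∧ x 1 < π) ∧ (0 < x 2 ∧ x 2 < π)}) :
    ∀ x : Fin 3 → ℝ, 0 < x 1 → x 1 < π → 0 < x 2 → x 2 < π →
      opA (lapOp rho K2mat f) x = lapOp rho K2mat (opA f) x := by
  intro x h1 h1' h2 h2'
  replace hf : ContDiffOn ℝ (⊤ : ℕ∞) f angleDomain := hf
  have key : restrict _ (contDiffOn_opA (contDiffOn_lapOp_K2mat hf)) =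
      restrict _ (contDiffOn_lapOp_K2mat (contDiffOn_opA hf)) := by
    rw [restrict_opA (contDiffOn_lapOp_K2mat hf), restrict_lapOp_K2mat hf,
      restrict_lapOp_K2mat (contDiffOn_opA hf), restrict_opA hf, opAExpanded_opK2Expanded]
  exact congrFun (congrArg Subtype.val key) ⟨x, ⟨h1, h1'⟩, h2, h2'⟩
end

section
/- Let Ω = {(q1,q2,q3,q4) ∈ ℝ⁴ : 0 < q2 < π, 0 < q3 < π, q4 > 0}, H2 = (1/2)p2² + (2/sin²q2)·p1², H3 = (1/2)p3² + (4/sin²q3)·H2, H4 = (1/2)p4² + (4/(q4)²)·H3, and K4 = cos(q3)·p4² − 4·sin(q3)·(1/q4)·p3·p4 − 8·cos(q3)·(1/(q4)²)·H3. Then {H4, K4} = 0 at every point of Ω × ℝ⁴. -/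
open Real

/-- Partial derivative of `F(q,p)` with respect to the coordinate `q i`. -/
noncomputable def pdq {n : ℕ} (i : Fin n) (F : (Fin n → ℝ) → (Fin n → ℝ) → ℝ)
    (q p : Fin n → ℝ) : ℝ :=
  deriv (fun t => F (Function.update q i t) p) (q i)

/-- Partial derivative of `F(q,p)` with respect to the momentum `p i`. -/
noncomputable def pdp {n : ℕ} (i : Fin n) (F : (Fin n → ℝ) → (Fin n → ℝ) → ℝ)
    (q p : Fin n → ℝ) : ℝ :=
  deriv (fun t => F q (Function.update p i t)) (p i)

/-- Canonical Poisson bracket `{F,G} = ∑ i, (∂F/∂qⁱ ∂G/∂pᵢ − ∂F/∂pᵢ ∂G/∂qⁱ)`. -/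
noncomputable def poissonBracket {n : ℕ} (F G : (Fin n → ℝ) → (Fin n → ℝ) → ℝ)
    (q p : Fin n → ℝ) : ℝ :=
  ∑ i, (pdq i F q p * pdp i G q p - pdp i F q p * pdq i G q p)

/-- `H2 = (1/2)p2² + (2/sin²q2) p1²`. -/
noncomputable def H2 (q p : Fin 4 → ℝ) : ℝ :=
  (1/2) * (p 1)^2 + (2/(sin (q 1))^2) * (p 0)^2

/-- `H3 = (1/2)p3² + (4/sin²q3) H2`. -/
noncomputable def H3 (q p : Fin 4 → ℝ) : ℝ :=
  (1/2) * (p 2)^2 + (4/(sin (q 2))^2) * H2 q p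

/-- `H4 = (1/2)p4² + (4/(q4)²) H3`. -/
noncomputable def H4 (q p : Fin 4 → ℝ) : ℝ :=
  (1/2) * (p 3)^2 + (4/(q 3)^2) * H3 q p

/-- `K4`, the additional quadratic first integral produced by the extension. -/
noncomputable def K4 (q p : Fin 4 → ℝ) : ℝ :=
  cos (q 2) * (p 3)^2 - 4 * sin (q 2) * (1/(q 3)) * (p 2) * (p 3) -
    8 * cos (q 2) * (1/(q 3)^2) * H3 q p

/-- Differential of `H2` at `(q, p)` in the direction `(v, w)`. -/
noncomputable def dH2 (q p v w : Fin 4 → ℝ) : ℝ :=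
  p 1 * w 1 - 4 * cos (q 1) / sin (q 1) ^ 3 * v 1 * p 0 ^ 2 + 4 / sin (q 1) ^ 2 * p 0 * w 0

/-- Differential of `H3` at `(q, p)` in the direction `(v, w)`. -/
noncomputable def dH3 (q p v w : Fin 4 → ℝ) : ℝ :=
  p 2 * w 2 - 8 * cos (q 2) / sin (q 2) ^ 3 * v 2 * H2 q p + 4 / sin (q 2) ^ 2 * dH2 q p v w

/-- Differential of `H4` at `(q, p)` in the direction `(v, w)`. -/
noncomputable def dH4 (q p v w : Fin 4 → ℝ) : ℝ :=
  p 3 * w 3 - 8 / q 3 ^ 3 * v 3 * H3 q p + 4 / q 3 ^ 2 * dH3 q p v w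

/-- Differential of `K4` at `(q, p)` in the direction `(v, w)`. -/
noncomputable def dK4 (q p v w : Fin 4 → ℝ) : ℝ :=
  -sin (q 2) * v 2 * p 3 ^ 2 + 2 * cos (q 2) * p 3 * w 3
    - 4 * (cos (q 2) * v 2 / q 3 * p 2 * p 3 - sin (q 2) / q 3 ^ 2 * v 3 * p 2 * p 3
      + sin (q 2) / q 3 * w 2 * p 3 + sin (q 2) / q 3 * p 2 * w 3)
    - 8 * (-sin (q 2) * v 2 / q 3 ^ 2 * H3 q p - 2 * cos (q 2) / q 3 ^ 3 * v 3 * H3 q p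
      + cos (q 2) / q 3 ^ 2 * dH3 q p v w)

section Curves

variable {Q P : ℝ → Fin 4 → ℝ} {v w : Fin 4 → ℝ} {t : ℝ}

theorem hasDerivAt_H2 (hQ : HasDerivAt Q v t) (hP : HasDerivAt P w t) (h1 : sin (Q t 1) ≠ 0) :
    HasDerivAt (fun s => H2 (Q s) (P s)) (dH2 (Q t) (P t) v w) t := by
  rw [hasDerivAt_pi] at hQ hP
  have h := (((hP 1).fun_pow 2).const_mul (1 / 2 : ℝ)).fun_add
    (((hasDerivAt_const t (2 : ℝ)).fun_div ((hQ 1).sin.fun_pow 2) (pow_ne_zero 2 h1)).fun_mul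
      ((hP 0).fun_pow 2))
  refine h.congr_deriv ?_
  simp only [dH2]
  field_simp
  ring

theorem hasDerivAt_H3 (hQ : HasDerivAt Q v t) (hP : HasDerivAt P w t) (h1 : sin (Q t 1) ≠ 0)
    (h2 : sin (Q t 2) ≠ 0) :
    HasDerivAt (fun s => H3 (Q s) (P s)) (dH3 (Q t) (P t) v w) t := by
  have hH := hasDerivAt_H2 hQ hP h1
  rw [hasDerivAt_pi] at hQ hP
  have h := (((hP 2).fun_pow 2).const_mul (1 / 2 : ℝ)).fun_add
    (((hasDerivAt_const t (4 : ℝ)).fun_div ((hQ 2).sin.fun_pow 2) (pow_ne_zero 2 h2)).fun_mul hH)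
  refine h.congr_deriv ?_
  simp only [dH3]
  field_simp
  ring

theorem hasDerivAt_H4 (hQ : HasDerivAt Q v t) (hP : HasDerivAt P w t) (h1 : sin (Q t 1) ≠ 0)
    (h2 : sin (Q t 2) ≠ 0) (h3 : Q t 3 ≠ 0) :
    HasDerivAt (fun s => H4 (Q s) (P s)) (dH4 (Q t) (P t) v w) t := by
  have hH := hasDerivAt_H3 hQ hP h1 h2
  rw [hasDerivAt_pi] at hQ hP
  have h := (((hP 3).fun_pow 2).const_mul (1 / 2 : ℝ)).fun_add
    (((hasDerivAt_const t (4 : ℝ)).fun_div ((hQ 3).fun_pow 2) (pow_ne_zero 2 h3)).fun_mul hH)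
  refine h.congr_deriv ?_
  simp only [dH4]
  field_simp
  ring

theorem hasDerivAt_K4 (hQ : HasDerivAt Q v t) (hP : HasDerivAt P w t) (h1 : sin (Q t 1) ≠ 0)
    (h2 : sin (Q t 2) ≠ 0) (h3 : Q t 3 ≠ 0) :
    HasDerivAt (fun s => K4 (Q s) (P s)) (dK4 (Q t) (P t) v w) t := by
  have hH := hasDerivAt_H3 hQ hP h1 h2
  rw [hasDerivAt_pi] at hQ hP
  have h := (((hQ 2).cos.fun_mul ((hP 3).fun_pow 2)).fun_sub
    (((((hQ 2).sin.const_mul (4 : ℝ)).fun_mul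
      ((hasDerivAt_const t (1 : ℝ)).fun_div (hQ 3) h3)).fun_mul (hP 2)).fun_mul (hP 3))).fun_sub
    ((((hQ 2).cos.const_mul (8 : ℝ)).fun_mul
      ((hasDerivAt_const t (1 : ℝ)).fun_div ((hQ 3).fun_pow 2) (pow_ne_zero 2 h3))).fun_mul hH)
  refine h.congr_deriv ?_
  simp only [dK4]
  field_simp
  ring

end Curves

section Partials

variable {n : ℕ} {F : (Fin n → ℝ) → (Fin n → ℝ) → ℝ}
  {dF : (Fin n → ℝ) → (Fin n → ℝ) → (Fin n → ℝ) → (Fin n → ℝ) → ℝ} {q p : Fin n → ℝ}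

theorem pdq_eq_of_hasDerivAt_curves
    (hF : ∀ (Q P : ℝ → Fin n → ℝ) (v w : Fin n → ℝ) (t : ℝ), HasDerivAt Q v t →
      HasDerivAt P w t → Q t = q → P t = p → HasDerivAt (fun s => F (Q s) (P s)) (dF q p v w) t)
    (i : Fin n) : pdq i F q p = dF q p (Pi.single i 1) 0 :=
  (hF _ _ _ _ _ (hasDerivAt_update q i (q i)) (hasDerivAt_const (q i) p)
    (Function.update_eq_self i q) rfl).deriv

theorem pdp_eq_of_hasDerivAt_curves
    (hF : ∀ (Q P : ℝ → Fin n → ℝ) (v w : Fin n → ℝ) (t : ℝ), HasDerivAt Q v t →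
      HasDerivAt P w t → Q t = q → P t = p → HasDerivAt (fun s => F (Q s) (P s)) (dF q p v w) t)
    (i : Fin n) : pdp i F q p = dF q p 0 (Pi.single i 1) :=
  (hF _ _ _ _ _ (hasDerivAt_const (p i) q) (hasDerivAt_update p i (p i))
    rfl (Function.update_eq_self i p)).deriv

end Partials

theorem stmt_10 (q p : Fin 4 → ℝ) (h2 : 0 < q 1) (h2' : q 1 < π)
    (h3 : 0 < q 2) (h3' : q 2 < π) (h4 : 0 < q 3) :
    poissonBracket H4 K4 q p = 0 := by
  have s1 : sin (q 1) ≠ 0 := (sin_pos_of_pos_of_lt_pi h2 h2').ne'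
  have s2 : sin (q 2) ≠ 0 := (sin_pos_of_pos_of_lt_pi h3 h3').ne'
  have x3 : q 3 ≠ 0 := h4.ne'
  have hH (Q P : ℝ → Fin 4 → ℝ) (v w : Fin 4 → ℝ) (t : ℝ) (hQ : HasDerivAt Q v t)
      (hP : HasDerivAt P w t) (eQ : Q t = q) (eP : P t = p) :
      HasDerivAt (fun s => H4 (Q s) (P s)) (dH4 q p v w) t := by
    subst eQ eP
    exact hasDerivAt_H4 hQ hP s1 s2 x3
  have hK (Q P : ℝ → Fin 4 → ℝ) (v w : Fin 4 → ℝ) (t : ℝ) (hQ : HasDerivAt Q v t)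
      (hP : HasDerivAt P w t) (eQ : Q t = q) (eP : P t = p) :
      HasDerivAt (fun s => K4 (Q s) (P s)) (dK4 q p v w) t := by
    subst eQ eP
    exact hasDerivAt_K4 hQ hP s1 s2 x3
  simp only [poissonBracket, pdq_eq_of_hasDerivAt_curves hH, pdp_eq_of_hasDerivAt_curves hH,
    pdq_eq_of_hasDerivAt_curves hK, pdp_eq_of_hasDerivAt_curves hK, Fin.sum_univ_four]
  simp [dH4, dK4, dH3, dH2, H3, H2]
  field_simp
  ring
end

section
/- Let Ω = {(q1,q2,q3,q4) ∈ ℝ⁴ : 0 < q2 < π, 0 < q3 < π, q4 > 0}, H2 = (1/2)p2² + (2/sin²q2)·p1², H3 = (1/2)p3² + (4/sin²q3)·H2, H4 = (1/2)p4² + (4/(q4)²)·H3, K2 = cos(q1)·p2² − 4·sin(q1)·(cos q2/sin q2)·p1·p2 − 4·cos(q1)·(cos²q2/sin²q2)·p1², and K3 = cos(q2)·p3² − 4·sin(q2)·(cos q3/sin q3)·p2·p3 − 8·cos(q2)·(cos²q3/sin²q3)·H2. Then {H4, K3} = 0 and {H4, K2} = 0 at every point of Ω × ℝ⁴. -/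
open Real

/-- `K2`, inherited from the two-dimensional system. -/
noncomputable def K2 (q p : Fin 4 → ℝ) : ℝ :=
  cos (q 0) * (p 1)^2 - 4 * sin (q 0) * (cos (q 1)/sin (q 1)) * (p 0) * (p 1) -
    4 * cos (q 0) * ((cos (q 1))^2/(sin (q 1))^2) * (p 0)^2

/-- `K3`, inherited from the three-dimensional system. -/
noncomputable def K3 (q p : Fin 4 → ℝ) : ℝ :=
  cos (q 1) * (p 2)^2 - 4 * sin (q 1) * (cos (q 2)/sin (q 2)) * (p 1) * (p 2) -
    8 * cos (q 1) * ((cos (q 2))^2/(sin (q 2))^2) * H2 q p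

/-- `F` has partial derivatives `a` in the coordinates and `b` in the momenta at `(q, p)`. -/
structure HasPartialDerivs {n : ℕ} (F : (Fin n → ℝ) → (Fin n → ℝ) → ℝ)
    (a b q p : Fin n → ℝ) : Prop where
  coord : ∀ i, HasDerivAt (fun t => F (Function.update q i t) p) (a i) (q i)
  momentum : ∀ i, HasDerivAt (fun t => F q (Function.update p i t)) (b i) (p i)

namespace HasPartialDerivs

variable {n : ℕ} {F G : (Fin n → ℝ) → (Fin n → ℝ) → ℝ} {a b c d q p : Fin n → ℝ}

theorem poissonBracket_eq (hF : HasPartialDerivs F a b q p) (hG : HasPartialDerivs G c d q p) :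
    poissonBracket F G q p = ∑ i, (a i * d i - b i * c i) := by
  simp only [poissonBracket, pdq, pdp, (hF.coord _).deriv, (hF.momentum _).deriv,
    (hG.coord _).deriv, (hG.momentum _).deriv]

theorem add (hF : HasPartialDerivs F a b q p) (hG : HasPartialDerivs G c d q p) :
    HasPartialDerivs (fun q p => F q p + G q p) (a + c) (b + d) q p :=
  ⟨fun i => (hF.coord i).add (hG.coord i), fun i => (hF.momentum i).add (hG.momentum i)⟩

theorem sub (hF : HasPartialDerivs F a b q p) (hG : HasPartialDerivs G c d q p) :
    HasPartialDerivs (fun q p => F q p - G q p) (a - c) (b - d) q p :=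
  ⟨fun i => (hF.coord i).sub (hG.coord i), fun i => (hF.momentum i).sub (hG.momentum i)⟩

theorem mul (hF : HasPartialDerivs F a b q p) (hG : HasPartialDerivs G c d q p) :
    HasPartialDerivs (fun q p => F q p * G q p) (G q p • a + F q p • c)
      (G q p • b + F q p • d) q p := by
  constructor <;> intro i
  · exact ((hF.coord i).mul (hG.coord i)).congr_deriv (by simp [mul_comm])
  · exact ((hF.momentum i).mul (hG.momentum i)).congr_deriv (by simp [mul_comm])

theorem of_coord {f : ℝ → ℝ} {f' : ℝ} (j : Fin n) (hf : HasDerivAt f f' (q j)) :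
    HasPartialDerivs (fun q _ => f (q j)) (Pi.single j f') 0 q p := by
  refine ⟨fun i => ?_, fun i => hasDerivAt_const _ _⟩
  rcases eq_or_ne j i with rfl | h
  · simpa using hf
  · simpa [h, h.symm] using hasDerivAt_const (q i) (f (q j))

theorem of_momentum {f : ℝ → ℝ} {f' : ℝ} (j : Fin n) (hf : HasDerivAt f f' (p j)) :
    HasPartialDerivs (fun _ p => f (p j)) 0 (Pi.single j f') q p := by
  refine ⟨fun i => hasDerivAt_const _ _, fun i => ?_⟩
  rcases eq_or_ne j i with rfl | h
  · simpa using hf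
  · simpa [h, h.symm] using hasDerivAt_const (p i) (f (p j))

end HasPartialDerivs

theorem hasDerivAt_const_div_sq (c : ℝ) {f : ℝ → ℝ} {f' x : ℝ} (hf : HasDerivAt f f' x)
    (hx : f x ≠ 0) : HasDerivAt (fun t => c / f t ^ 2) (-2 * c * f' / f x ^ 3) x := by
  refine ((hasDerivAt_const x c).div (hf.pow 2) (pow_ne_zero 2 hx)).congr_deriv ?_
  simp only [Pi.pow_apply]
  field_simp
  ring

theorem hasDerivAt_cos_div_sin {x : ℝ} (hx : sin x ≠ 0) :
    HasDerivAt (fun t => cos t / sin t) (-1 / sin x ^ 2) x := by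
  refine ((hasDerivAt_cos x).div (hasDerivAt_sin x) hx).congr_deriv ?_
  congr 1
  linear_combination -sin_sq_add_cos_sq x

theorem hasDerivAt_cos_sq_div_sin_sq {x : ℝ} (hx : sin x ≠ 0) :
    HasDerivAt (fun t => cos t ^ 2 / sin t ^ 2) (-2 * cos x / sin x ^ 3) x := by
  simp only [← div_pow]
  refine ((hasDerivAt_cos_div_sin hx).pow 2).congr_deriv ?_
  simp only [Nat.cast_ofNat, Nat.add_one_sub_one, pow_one]
  field_simp

theorem hasDerivAt_const_mul_sq (c x : ℝ) :
    HasDerivAt (fun t => c * t ^ 2) (2 * c * x) x :=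
  ((hasDerivAt_pow 2 x).const_mul c).congr_deriv (by ring)

theorem hasDerivAt_sq (x : ℝ) : HasDerivAt (fun t => t ^ 2) (2 * x) x := by
  simpa using hasDerivAt_pow 2 x

theorem stmt_11 (q p : Fin 4 → ℝ) (h2 : 0 < q 1) (h2' : q 1 < π)
    (h3 : 0 < q 2) (h3' : q 2 < π) (h4 : 0 < q 3) :
    poissonBracket H4 K3 q p = 0 ∧ poissonBracket H4 K2 q p = 0 := by
  have hs1 : sin (q 1) ≠ 0 := (sin_pos_of_pos_of_lt_pi h2 h2').ne'
  have hs2 : sin (q 2) ≠ 0 := (sin_pos_of_pos_of_lt_pi h3 h3').ne'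
  have hq3 : q 3 ≠ 0 := h4.ne'
  have dH2 := (HasPartialDerivs.of_momentum (q := q) 1 (hasDerivAt_const_mul_sq (1 / 2) (p 1))).add
    ((HasPartialDerivs.of_coord 1 (hasDerivAt_const_div_sq 2 (hasDerivAt_sin _) hs1)).mul
      (.of_momentum 0 (hasDerivAt_sq _)))
  have dH3 := (HasPartialDerivs.of_momentum 2 (hasDerivAt_const_mul_sq (1 / 2) _)).add
    ((HasPartialDerivs.of_coord 2 (hasDerivAt_const_div_sq 4 (hasDerivAt_sin _) hs2)).mul dH2)
  have dH4 := (HasPartialDerivs.of_momentum 3 (hasDerivAt_const_mul_sq (1 / 2) _)).add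
    ((HasPartialDerivs.of_coord 3 (hasDerivAt_const_div_sq 4 (hasDerivAt_id _) hq3)).mul dH3)
  have dK2 := (((HasPartialDerivs.of_coord 0 (hasDerivAt_cos _)).mul
      (.of_momentum 1 (hasDerivAt_sq (p 1)))).sub
    ((((HasPartialDerivs.of_coord 0 ((hasDerivAt_sin _).const_mul 4)).mul
      (.of_coord 1 (hasDerivAt_cos_div_sin hs1))).mul
      (.of_momentum 0 (hasDerivAt_id _))).mul (.of_momentum 1 (hasDerivAt_id _)))).sub
    (((HasPartialDerivs.of_coord 0 ((hasDerivAt_cos _).const_mul 4)).mul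
      (.of_coord 1 (hasDerivAt_cos_sq_div_sin_sq hs1))).mul (.of_momentum 0 (hasDerivAt_sq _)))
  have dK3 := (((HasPartialDerivs.of_coord 1 (hasDerivAt_cos _)).mul
      (.of_momentum 2 (hasDerivAt_sq (p 2)))).sub
    ((((HasPartialDerivs.of_coord 1 ((hasDerivAt_sin _).const_mul 4)).mul
      (.of_coord 2 (hasDerivAt_cos_div_sin hs2))).mul
      (.of_momentum 1 (hasDerivAt_id _))).mul (.of_momentum 2 (hasDerivAt_id _)))).sub
    (((HasPartialDerivs.of_coord 1 ((hasDerivAt_cos _).const_mul 8)).mul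
      (.of_coord 2 (hasDerivAt_cos_sq_div_sin_sq hs2))).mul dH2)
  constructor
  · refine (dH4.poissonBracket_eq dK3).trans ?_
    simp [Fin.sum_univ_four, Pi.single_apply]
    field_simp
    ring
  · refine (dH4.poissonBracket_eq dK2).trans ?_
    simp [Fin.sum_univ_four, Pi.single_apply]
    field_simp
    ring
end

section
/- Let Ω = {(q1,q2,q3,q4) ∈ ℝ⁴ : 0 < q2 < π, 0 < q3 < π, 0 < q4 < π}, H2 = (1/2)p2² + (2/sin²q2)·p1², H3 = (1/2)p3² + (4/sin²q3)·H2, H'4 = (1/2)p4² + (4/sin²q4)·H3, and K'4 = cos(q3)·p4² − 4·sin(q3)·(cos q4/sin q4)·p3·p4 − 8·cos(q3)·(cos²q4/sin²q4)·H3. Then {H'4, K'4} = 0 at every point of Ω × ℝ⁴. -/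
open Real

/-- `H'4 = (1/2)p4² + (4/sin²q4) H3`. -/
noncomputable def H4' (q p : Fin 4 → ℝ) : ℝ :=
  (1/2) * (p 3)^2 + (4/(sin (q 3))^2) * H3 q p

/-- `K'4`, the additional quadratic first integral produced by the extension. -/
noncomputable def K4' (q p : Fin 4 → ℝ) : ℝ :=
  cos (q 2) * (p 3)^2 - 4 * sin (q 2) * (cos (q 3)/sin (q 3)) * (p 2) * (p 3) -
    8 * cos (q 2) * ((cos (q 3))^2/(sin (q 3))^2) * H3 q p

theorem hasDerivAt_div_sin_sq (a : ℝ) {x : ℝ} (hx : sin x ≠ 0) :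
    HasDerivAt (fun t => a / sin t ^ 2) (-2 * a * cos x / sin x ^ 3) x := by
  refine ((hasDerivAt_const x a).div ((hasDerivAt_sin x).pow 2) (pow_ne_zero 2 hx)).congr_deriv ?_
  simp
  field_simp

theorem hasDerivAt_cot {x : ℝ} (hx : sin x ≠ 0) :
    HasDerivAt (fun t => cos t / sin t) (-(1 / sin x ^ 2)) x := by
  refine ((hasDerivAt_cos x).div (hasDerivAt_sin x) hx).congr_deriv ?_
  field_simp
  linear_combination -sin_sq_add_cos_sq x

theorem hasDerivAt_cot_sq {x : ℝ} (hx : sin x ≠ 0) :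
    HasDerivAt (fun t => cos t ^ 2 / sin t ^ 2) (-(2 * cos x / sin x ^ 3)) x := by
  simp only [← div_pow]
  refine ((hasDerivAt_cot hx).pow 2).congr_deriv ?_
  simp
  field_simp

/-- Momentum gradient of `H3`. -/
noncomputable def gradH3p (q p : Fin 4 → ℝ) : Fin 4 → ℝ :=
  ![4 / sin (q 2) ^ 2 * (4 / sin (q 1) ^ 2 * p 0), 4 / sin (q 2) ^ 2 * p 1, p 2, 0]

/-- Position gradient of `H3`. -/
noncomputable def gradH3q (q p : Fin 4 → ℝ) : Fin 4 → ℝ :=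
  ![0, 4 / sin (q 2) ^ 2 * (-2 * 2 * cos (q 1) / sin (q 1) ^ 3 * p 0 ^ 2),
    -2 * 4 * cos (q 2) / sin (q 2) ^ 3 * H2 q p, 0]

theorem hasDerivAt_H3_update_p (q p : Fin 4 → ℝ) (i : Fin 4) :
    HasDerivAt (fun t => H3 q (Function.update p i t)) (gradH3p q p i) (p i) := by
  have hu (j : Fin 4) : HasDerivAt (fun t => Function.update p i t j)
      ((Pi.single i (1 : ℝ) : Fin 4 → ℝ) j) (p i) :=
    hasDerivAt_pi.1 (hasDerivAt_update p i (p i)) j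
  have h2 := (((hu 1).pow 2).const_mul (1 / 2)).add
    (((hu 0).pow 2).const_mul (2 / sin (q 1) ^ 2))
  have h3 := (((hu 2).pow 2).const_mul (1 / 2)).add (h2.const_mul (4 / sin (q 2) ^ 2))
  refine h3.congr_deriv ?_
  fin_cases i <;> simp [gradH3p, -mul_eq_mul_left_iff] <;> ring

theorem hasDerivAt_H3_update_q {q : Fin 4 → ℝ} (p : Fin 4 → ℝ) (h1 : sin (q 1) ≠ 0)
    (h2 : sin (q 2) ≠ 0) (i : Fin 4) :
    HasDerivAt (fun t => H3 (Function.update q i t) p) (gradH3q q p i) (q i) := by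
  fin_cases i
  · simpa [H3, H2, gradH3q] using hasDerivAt_const (q 0) (H3 q p)
  · simpa [H3, H2, gradH3q] using
      ((((hasDerivAt_div_sin_sq 2 h1).mul_const (p 0 ^ 2)).const_add
        (1 / 2 * p 1 ^ 2)).const_mul (4 / sin (q 2) ^ 2)).const_add (1 / 2 * p 2 ^ 2)
  · simpa [H3, H2, gradH3q] using
      ((hasDerivAt_div_sin_sq 4 h2).mul_const (H2 q p)).const_add (1 / 2 * p 2 ^ 2)
  · simpa [H3, H2, gradH3q] using hasDerivAt_const (q 3) (H3 q p)

theorem stmt_15 (q p : Fin 4 → ℝ) (h2 : 0 < q 1) (h2' : q 1 < π)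
    (h3 : 0 < q 2) (h3' : q 2 < π) (h4 : 0 < q 3) (h4' : q 3 < π) :
    poissonBracket H4' K4' q p = 0 := by
  have s1 : sin (q 1) ≠ 0 := (sin_pos_of_pos_of_lt_pi h2 h2').ne'
  have s2 : sin (q 2) ≠ 0 := (sin_pos_of_pos_of_lt_pi h3 h3').ne'
  have s3 : sin (q 3) ≠ 0 := (sin_pos_of_pos_of_lt_pi h4 h4').ne'
  have hu (i j : Fin 4) : HasDerivAt (fun t => Function.update p i t j)
      ((Pi.single i (1 : ℝ) : Fin 4 → ℝ) j) (p i) :=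
    hasDerivAt_pi.1 (hasDerivAt_update p i (p i)) j
  have hv (i j : Fin 4) : HasDerivAt (fun t => Function.update q i t j)
      ((Pi.single i (1 : ℝ) : Fin 4 → ℝ) j) (q i) :=
    hasDerivAt_pi.1 (hasDerivAt_update q i (q i)) j
  have comp (i j : Fin 4) {f : ℝ → ℝ} {f' : ℝ} (hf : HasDerivAt f f' (q j)) :
      HasDerivAt (fun t => f (Function.update q i t j))
        (f' * (Pi.single i (1 : ℝ) : Fin 4 → ℝ) j) (q i) :=
    HasDerivAt.comp (q i) (by simpa using hf) (hv i j)
  have hHp (i : Fin 4) := ((((hu i 3).pow 2).const_mul (1 / 2)).add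
    ((hasDerivAt_H3_update_p q p i).const_mul (4 / sin (q 3) ^ 2))).deriv
  have hHq (i : Fin 4) := (((comp i 3 (hasDerivAt_div_sin_sq 4 s3)).mul
    (hasDerivAt_H3_update_q p s1 s2 i)).const_add (1 / 2 * p 3 ^ 2)).deriv
  have hKp (i : Fin 4) := (((((hu i 3).pow 2).const_mul (cos (q 2))).sub
    (((hu i 2).const_mul (4 * sin (q 2) * (cos (q 3) / sin (q 3)))).mul (hu i 3))).sub
    ((hasDerivAt_H3_update_p q p i).const_mul
      (8 * cos (q 2) * (cos (q 3) ^ 2 / sin (q 3) ^ 2)))).deriv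
  have hKq (i : Fin 4) := ((((comp i 2 (hasDerivAt_cos _)).mul_const (p 3 ^ 2)).sub
    (((((comp i 2 (hasDerivAt_sin _)).const_mul 4).mul
      (comp i 3 (hasDerivAt_cot s3))).mul_const (p 2)).mul_const (p 3))).sub
    ((((comp i 2 (hasDerivAt_cos _)).const_mul 8).mul
      (comp i 3 (hasDerivAt_cot_sq s3))).mul (hasDerivAt_H3_update_q p s1 s2 i))).deriv
  have eHp (i : Fin 4) : pdp i H4' q p = _ := hHp i
  have eHq (i : Fin 4) : pdq i H4' q p = _ := hHq i
  have eKp (i : Fin 4) : pdp i K4' q p = _ := hKp i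
  have eKq (i : Fin 4) : pdq i K4' q p = _ := hKq i
  simp only [poissonBracket, Fin.sum_univ_four, eHp, eHq, eKp, eKq]
  simp [gradH3p, gradH3q, H3]
  field_simp
  ring
end
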